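/- Let s ∈ (0,1), Ω ⊂ ℝ^{n+1}_+ bounded, u ∈ H¹(ℝ^{n+1}_+, x_{n+1}^{1−2s}) smooth with vanishing trace on {x_{n+1}=0}, and let ζ ∈ C^∞(ℝ) satisfy ζ = 1 on [0,1], ζ = 0 on [2,∞), 0 ≤ ζ ≤ 1. Define w_m(x) := u(x)(1 − ζ(m x_{n+1})). Then ‖∇(w_m − u)‖_{L²(ℝ^{n+1}_+, x_{n+1}^{1−2s})} → 0 and ‖w_m − u‖_{L²(ℝ^{n+1}_+, x_{n+1}^{1−2s})} → 0 as m → ∞. In particular, functions vanishing near {x_{n+1} = 0} are dense (in the weighted H¹ norm) among weighted H¹ functions with zero trace. -/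

import Mathlib

open MeasureTheory Filter

theorem ENNReal.lintegral_mul_sq_le {α : Type*} [MeasurableSpace α] (μ : Measure α)
    {f g : α → ENNReal} (hf : AEMeasurable f μ) (hg : AEMeasurable g μ) :
    (∫⁻ a, f a * g a ∂μ) ^ 2 ≤ (∫⁻ a, f a ^ 2 ∂μ) * ∫⁻ a, g a ^ 2 ∂μ := by
  have h := ENNReal.lintegral_mul_le_Lp_mul_Lq μ Real.HolderConjugate.two_two hf hg
  simp only [Pi.mul_apply, ENNReal.rpow_two] at h
  calc (∫⁻ a, f a * g a ∂μ) ^ 2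
      ≤ ((∫⁻ a, f a ^ 2 ∂μ) ^ (1 / 2 : ℝ) * (∫⁻ a, g a ^ 2 ∂μ) ^ (1 / 2 : ℝ)) ^ 2 := by gcongr
    _ = _ := by
      rw [mul_pow, ← ENNReal.rpow_two, ← ENNReal.rpow_two, ← ENNReal.rpow_mul, ← ENNReal.rpow_mul]
      norm_num

theorem lintegral_Ioc_rpow {a t : ℝ} (ha : -1 < a) (ht : 0 ≤ t) :
    ∫⁻ r in Set.Ioc 0 t, ENNReal.ofReal (r ^ a) = ENNReal.ofReal (t ^ (a + 1) / (a + 1)) := by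
  have hi : IntervalIntegrable (fun r : ℝ => r ^ a) volume 0 t :=
    intervalIntegral.intervalIntegrable_rpow' ha
  rw [← ofReal_integral_eq_lintegral_ofReal]
  · rw [← intervalIntegral.integral_of_le ht, integral_rpow (Or.inl ha),
      Real.zero_rpow (by linarith), sub_zero]
  · exact (intervalIntegrable_iff_integrableOn_Ioc_of_le ht).1 hi
  · filter_upwards [self_mem_ae_restrict measurableSet_Ioc] with r hr
    exact Real.rpow_nonneg hr.1.le _

/-- Weighted one-dimensional trace estimate for functions vanishing at the origin. -/
theorem enorm_sq_le_lintegral_weighted_deriv {F : Type*} [NormedAddCommGroup F] [NormedSpace ℝ F]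
    {f : ℝ → F} (hf : ContDiff ℝ 1 f) (hf0 : f 0 = 0) {s t : ℝ} (hs : 0 < s) (ht : 0 ≤ t) :
    ‖f t‖ₑ ^ 2 ≤ ENNReal.ofReal (t ^ (2 * s) / (2 * s)) *
      ∫⁻ r in Set.Ioc 0 t, ENNReal.ofReal (r ^ (1 - 2 * s)) * ‖deriv f r‖ₑ ^ 2 := by
  have hd : Continuous (deriv f) := hf.continuous_deriv le_rfl
  have h1 : ‖f t‖ₑ ≤ ∫⁻ r in Set.Ioc 0 t, ‖deriv f r‖ₑ := by
    have := enorm_sub_le_lintegral_deriv_of_contDiffOn_Icc hf.contDiffOn ht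
    rwa [hf0, sub_zero, ← restrict_Ioc_eq_restrict_Icc] at this
  have hsq (b r : ℝ) (hr : 0 < r) :
      ENNReal.ofReal (r ^ (b / 2)) ^ 2 = ENNReal.ofReal (r ^ b) := by
    rw [← ENNReal.ofReal_pow (Real.rpow_nonneg hr.le _), ← Real.rpow_natCast, ← Real.rpow_mul hr.le]
    norm_num
  have h2 : ∫⁻ r in Set.Ioc 0 t, ‖deriv f r‖ₑ = ∫⁻ r in Set.Ioc 0 t,
      ENNReal.ofReal (r ^ ((2 * s - 1) / 2)) *
        (ENNReal.ofReal (r ^ ((1 - 2 * s) / 2)) * ‖deriv f r‖ₑ) := by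
    refine setLIntegral_congr_fun measurableSet_Ioc fun r hr => ?_
    rw [← mul_assoc, ← ENNReal.ofReal_mul (Real.rpow_nonneg hr.1.le _), ← Real.rpow_add hr.1]
    rw [show (2 * s - 1) / 2 + (1 - 2 * s) / 2 = 0 by ring, Real.rpow_zero, ENNReal.ofReal_one,
      one_mul]
  have h3 : ∫⁻ r in Set.Ioc 0 t, ENNReal.ofReal (r ^ ((2 * s - 1) / 2)) ^ 2 =
      ENNReal.ofReal (t ^ (2 * s) / (2 * s)) := by
    rw [setLIntegral_congr_fun measurableSet_Ioc (fun r hr => hsq (2 * s - 1) r hr.1),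
      lintegral_Ioc_rpow (by linarith) ht, sub_add_cancel]
  have h4 : ∫⁻ r in Set.Ioc 0 t, (ENNReal.ofReal (r ^ ((1 - 2 * s) / 2)) * ‖deriv f r‖ₑ) ^ 2 =
      ∫⁻ r in Set.Ioc 0 t, ENNReal.ofReal (r ^ (1 - 2 * s)) * ‖deriv f r‖ₑ ^ 2 := by
    refine setLIntegral_congr_fun measurableSet_Ioc fun r hr => ?_
    simp only [mul_pow, hsq _ r hr.1]
  calc ‖f t‖ₑ ^ 2 ≤ (∫⁻ r in Set.Ioc 0 t, ‖deriv f r‖ₑ) ^ 2 := by gcongr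
    _ ≤ _ := by
      rw [h2, ← h3, ← h4]
      have hm (a : ℝ) : Measurable fun r : ℝ => ENNReal.ofReal (r ^ a) := by fun_prop
      exact ENNReal.lintegral_mul_sq_le _ (hm _).aemeasurable
        ((hm _).mul hd.enorm.measurable).aemeasurable

section Slab

variable {E F : Type*} [NormedAddCommGroup E] [NormedSpace ℝ E] [NormedAddCommGroup F]
  [NormedSpace ℝ F]

theorem enorm_deriv_slice_le {u : E × ℝ → F} (hu : Differentiable ℝ u) (x : E) (r : ℝ) :
    ‖deriv (fun t => u (x, t)) r‖ₑ ≤ ‖fderiv ℝ u (x, r)‖ₑ := by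
  have h : HasDerivAt (fun t => u (x, t)) (fderiv ℝ u (x, r) (0, 1)) r :=
    (hu (x, r)).hasFDerivAt.comp_hasDerivAt r ((hasDerivAt_const r x).prodMk (hasDerivAt_id r))
  rw [h.deriv, ← ofReal_norm, ← ofReal_norm]
  refine ENNReal.ofReal_le_ofReal ((ContinuousLinearMap.le_opNorm _ _).trans ?_)
  simp [Prod.norm_def]

theorem norm_fderiv_smul_snd_le {u : E × ℝ → F} {η : ℝ → ℝ} {p : E × ℝ}
    (hu : DifferentiableAt ℝ u p) (hη : DifferentiableAt ℝ η p.2) :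
    ‖fderiv ℝ (fun q : E × ℝ => η q.2 • u q) p‖ ≤
      |η p.2| * ‖fderiv ℝ u p‖ + |deriv η p.2| * ‖u p‖ := by
  have h1 : HasFDerivAt (fun q : E × ℝ => η q.2)
      (deriv η p.2 • ContinuousLinearMap.snd ℝ E ℝ) p :=
    hη.hasDerivAt.comp_hasFDerivAt p hasFDerivAt_snd
  have h2 : HasFDerivAt (fun q : E × ℝ => η q.2 • u q) _ p := h1.smul hu.hasFDerivAt
  rw [h2.fderiv]
  refine (norm_add_le _ _).trans ?_
  refine add_le_add (norm_smul _ _).le ?_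
  rw [ContinuousLinearMap.norm_smulRight_apply, norm_smul, Real.norm_eq_abs]
  have := ContinuousLinearMap.norm_snd_le (𝕜 := ℝ) (E := E) (F := ℝ)
  gcongr
  exact mul_le_of_le_one_right (abs_nonneg _) this

variable [MeasureSpace E] [BorelSpace E]
  [SFinite (volume : Measure E)]

/-- Hardy-type estimate on a slab for functions with zero trace. -/
theorem lintegral_slab_weighted_norm_sq_le {u : E × ℝ → F} (hu : ContDiff ℝ 1 u)
    (hu0 : ∀ x, u (x, 0) = 0) {s T : ℝ} (hs : 0 < s) (hT : 0 ≤ T) :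
    ∫⁻ p in {p : E × ℝ | p.2 ∈ Set.Ioc 0 T}, ENNReal.ofReal (p.2 ^ (1 - 2 * s) * ‖u p‖ ^ 2) ≤
      ENNReal.ofReal (T ^ 2 / (2 * s)) * ∫⁻ p in {p : E × ℝ | p.2 ∈ Set.Ioc 0 T},
        ENNReal.ofReal (p.2 ^ (1 - 2 * s) * ‖fderiv ℝ u p‖ ^ 2) := by
  have hA : (volume : Measure (E × ℝ)).restrict {p : E × ℝ | p.2 ∈ Set.Ioc 0 T} =
      (volume : Measure E).prod ((volume : Measure ℝ).restrict (Set.Ioc 0 T)) := by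
    have : {p : E × ℝ | p.2 ∈ Set.Ioc 0 T} = Set.univ ×ˢ Set.Ioc 0 T := by ext; simp
    rw [this, Measure.volume_eq_prod, ← Measure.prod_restrict, Measure.restrict_univ]
  have hm : Measurable fun p : E × ℝ =>
      ENNReal.ofReal (p.2 ^ (1 - 2 * s) * ‖fderiv ℝ u p‖ ^ 2) := by
    have := (hu.continuous_fderiv one_ne_zero).norm.measurable
    fun_prop
  rw [hA, lintegral_prod _ hm.aemeasurable]
  refine (lintegral_prod_le _).trans ?_
  rw [← lintegral_const_mul' _ _ ENNReal.ofReal_ne_top]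
  refine lintegral_mono fun x => ?_
  set Φ := ∫⁻ r in Set.Ioc 0 T, ENNReal.ofReal (r ^ (1 - 2 * s) * ‖fderiv ℝ u (x, r)‖ ^ 2)
  have hpt : ∀ t ∈ Set.Ioc 0 T, ENNReal.ofReal (t ^ (1 - 2 * s) * ‖u (x, t)‖ ^ 2) ≤
      ENNReal.ofReal (T / (2 * s)) * Φ := by
    intro t ht
    have hslice := enorm_sq_le_lintegral_weighted_deriv (f := fun t => u (x, t))
      (hu.comp (contDiff_const.prodMk contDiff_id)) (hu0 x) hs ht.1.le
    have hΦ : ∫⁻ r in Set.Ioc 0 t, ENNReal.ofReal (r ^ (1 - 2 * s)) *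
        ‖deriv (fun t => u (x, t)) r‖ₑ ^ 2 ≤ Φ := by
      refine (setLIntegral_mono' measurableSet_Ioc fun r hr => ?_).trans
        (lintegral_mono_set (Set.Ioc_subset_Ioc_right ht.2))
      rw [ENNReal.ofReal_mul (Real.rpow_nonneg hr.1.le _), ENNReal.ofReal_pow (norm_nonneg _),
        ofReal_norm]
      gcongr
      exact enorm_deriv_slice_le (hu.differentiable one_ne_zero) x r
    have hw : t ^ (1 - 2 * s) * (t ^ (2 * s) / (2 * s)) = t / (2 * s) := by
      rw [mul_div_assoc', ← Real.rpow_add ht.1]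
      simp
    have ht2 := ht.2
    calc ENNReal.ofReal (t ^ (1 - 2 * s) * ‖u (x, t)‖ ^ 2)
        = ENNReal.ofReal (t ^ (1 - 2 * s)) * ‖u (x, t)‖ₑ ^ 2 := by
          rw [ENNReal.ofReal_mul (Real.rpow_nonneg ht.1.le _), ENNReal.ofReal_pow (norm_nonneg _),
            ofReal_norm]
      _ ≤ ENNReal.ofReal (t ^ (1 - 2 * s)) * (ENNReal.ofReal (t ^ (2 * s) / (2 * s)) * Φ) := by
          gcongr
          exact hslice.trans (by gcongr)
      _ = ENNReal.ofReal (t / (2 * s)) * Φ := by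
          rw [← mul_assoc, ← ENNReal.ofReal_mul (Real.rpow_nonneg ht.1.le _), hw]
      _ ≤ _ := by gcongr
  refine (setLIntegral_mono' measurableSet_Ioc hpt).trans ?_
  rw [setLIntegral_const, Real.volume_Ioc, sub_zero, mul_right_comm,
    ← ENNReal.ofReal_mul (by positivity)]
  gcongr
  exact le_of_eq (by ring)

/-- Energy of a cutoff supported in a thin slab, against the energy of the function there. -/
theorem lintegral_weighted_energy_smul_le {u : E × ℝ → F} (hu : ContDiff ℝ 1 u)
    (hu0 : ∀ x, u (x, 0) = 0) {s T L : ℝ} (hs : 0 < s) (hT : 0 ≤ T) {η : ℝ → ℝ}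
    (hη : Differentiable ℝ η) (hη1 : ∀ t, |η t| ≤ 1) (hηT : ∀ t, T ≤ t → η t = 0)
    (hηL : ∀ t ∈ Set.Ioc 0 T, |deriv η t| ≤ L) :
    ∫⁻ p in {p : E × ℝ | 0 < p.2}, ENNReal.ofReal (p.2 ^ (1 - 2 * s) * (‖η p.2 • u p‖ ^ 2 +
        ‖fderiv ℝ (fun q : E × ℝ => η q.2 • u q) p‖ ^ 2)) ≤
      ENNReal.ofReal (2 + L ^ 2 * T ^ 2 / s) * ∫⁻ p in {p : E × ℝ | p.2 ∈ Set.Ioc 0 T},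
        ENNReal.ofReal (p.2 ^ (1 - 2 * s) * (‖u p‖ ^ 2 + ‖fderiv ℝ u p‖ ^ 2)) := by
  have hAm : MeasurableSet {p : E × ℝ | p.2 ∈ Set.Ioc 0 T} := measurable_snd measurableSet_Ioc
  have hSm : MeasurableSet {p : E × ℝ | 0 < p.2} := measurable_snd measurableSet_Ioi
  have hsub : {p : E × ℝ | p.2 ∈ Set.Ioc 0 T} ⊆ {p : E × ℝ | 0 < p.2} := fun p hp => hp.1
  have hvanish : ∀ p ∈ {p : E × ℝ | 0 < p.2} \ {p : E × ℝ | p.2 ∈ Set.Ioc 0 T},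
      ENNReal.ofReal (p.2 ^ (1 - 2 * s) * (‖η p.2 • u p‖ ^ 2 +
        ‖fderiv ℝ (fun q : E × ℝ => η q.2 • u q) p‖ ^ 2)) = 0 := by
    rintro p ⟨hp0, hpT⟩
    have hp : T < p.2 := by
      by_contra! h
      exact hpT ⟨hp0, h⟩
    have hd : deriv η p.2 = 0 := by
      have : η =ᶠ[nhds p.2] fun _ => 0 := by
        filter_upwards [lt_mem_nhds hp] with t ht using hηT t ht.le
      rw [this.deriv_eq, deriv_const]
    have hn := norm_fderiv_smul_snd_le (hu.differentiable one_ne_zero p) (hη p.2)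
    rw [hηT _ hp.le, hd] at hn
    have hz : ‖fderiv ℝ (fun q : E × ℝ => η q.2 • u q) p‖ = 0 :=
      le_antisymm (by simpa using hn) (norm_nonneg _)
    rw [hz, hηT _ hp.le]
    simp
  rw [← lintegral_inter_add_sdiff _ {p : E × ℝ | 0 < p.2} hAm,
    setLIntegral_congr_fun (hSm.diff hAm) hvanish, lintegral_zero, add_zero,
    Set.inter_eq_right.2 hsub]
  have hpt : ∀ p ∈ {p : E × ℝ | p.2 ∈ Set.Ioc 0 T},
      ENNReal.ofReal (p.2 ^ (1 - 2 * s) * (‖η p.2 • u p‖ ^ 2 +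
        ‖fderiv ℝ (fun q : E × ℝ => η q.2 • u q) p‖ ^ 2)) ≤
      ENNReal.ofReal 2 * ENNReal.ofReal (p.2 ^ (1 - 2 * s) * (‖u p‖ ^ 2 + ‖fderiv ℝ u p‖ ^ 2)) +
      ENNReal.ofReal (2 * L ^ 2) * ENNReal.ofReal (p.2 ^ (1 - 2 * s) * ‖u p‖ ^ 2) := by
    intro p hp
    have hw : 0 ≤ p.2 ^ (1 - 2 * s) := Real.rpow_nonneg hp.1.le _
    rw [← ENNReal.ofReal_mul (by positivity), ← ENNReal.ofReal_mul (by positivity),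
      ← ENNReal.ofReal_add (by positivity) (by positivity)]
    refine ENNReal.ofReal_le_ofReal ?_
    have h1 : ‖η p.2 • u p‖ ≤ ‖u p‖ := by
      rw [norm_smul]
      exact mul_le_of_le_one_left (norm_nonneg _) (hη1 _)
    have h2 : ‖fderiv ℝ (fun q : E × ℝ => η q.2 • u q) p‖ ≤ ‖fderiv ℝ u p‖ + L * ‖u p‖ := by
      refine (norm_fderiv_smul_snd_le (hu.differentiable one_ne_zero p) (hη p.2)).trans ?_
      gcongr
      · exact mul_le_of_le_one_left (norm_nonneg _) (hη1 _)
      · exact hηL _ hp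
    have h3 := pow_le_pow_left₀ (norm_nonneg _) h1 2
    have h4 := pow_le_pow_left₀ (norm_nonneg _) h2 2
    calc _ ≤ p.2 ^ (1 - 2 * s) *
          (2 * (‖u p‖ ^ 2 + ‖fderiv ℝ u p‖ ^ 2) + 2 * L ^ 2 * ‖u p‖ ^ 2) := by
          refine mul_le_mul_of_nonneg_left ?_ hw
          nlinarith [sq_nonneg (‖fderiv ℝ u p‖ - L * ‖u p‖), sq_nonneg ‖u p‖]
      _ = _ := by ring
  refine (setLIntegral_mono' hAm hpt).trans ?_
  have hm1 : Measurable fun p : E × ℝ =>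
      ENNReal.ofReal (p.2 ^ (1 - 2 * s) * ‖u p‖ ^ 2) := by
    have := hu.continuous.norm.measurable
    fun_prop
  rw [lintegral_add_right _ (hm1.const_mul _), lintegral_const_mul' _ _ ENNReal.ofReal_ne_top,
    lintegral_const_mul' _ _ ENNReal.ofReal_ne_top, ENNReal.ofReal_add (by norm_num) (by positivity),
    add_mul]
  refine add_le_add le_rfl ?_
  refine (mul_le_mul_right (lintegral_slab_weighted_norm_sq_le hu hu0 hs hT) _).trans ?_
  rw [← mul_assoc, ← ENNReal.ofReal_mul (by positivity)]
  refine mul_le_mul' (le_of_eq (by congr 1; field_simp)) (setLIntegral_mono' hAm fun p hp => ?_)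
  have hw : 0 ≤ p.2 ^ (1 - 2 * s) := Real.rpow_nonneg hp.1.le _
  gcongr
  exact le_add_of_nonneg_left (sq_nonneg _)

end Slab

/-- The energy in the slabs of width `2 / (m + 1)` tends to zero. -/
theorem tendsto_lintegral_slab {E : Type*} [MeasureSpace E] {g : E × ℝ → ℝ} (hg : IntegrableOn g {p : E × ℝ | 0 < p.2})
    (hg0 : ∀ p : E × ℝ, 0 < p.2 → 0 ≤ g p) :
    Tendsto (fun m : ℕ => ∫⁻ p in {p : E × ℝ | p.2 ∈ Set.Ioc 0 (2 / (m + 1 : ℝ))},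
      ENNReal.ofReal (g p)) atTop (nhds 0) := by
  have hAm (m : ℕ) : MeasurableSet {p : E × ℝ | p.2 ∈ Set.Ioc 0 (2 / (m + 1 : ℝ))} :=
    measurable_snd measurableSet_Ioc
  have hgi (m : ℕ) : IntegrableOn g {p : E × ℝ | p.2 ∈ Set.Ioc 0 (2 / (m + 1 : ℝ))} :=
    hg.mono_set fun p hp => hp.1
  have hlim := tendsto_setIntegral_of_antitone (μ := volume) (f := g) hAm
    (fun m k hmk p hp => ⟨hp.1, hp.2.trans (by gcongr)⟩) ⟨0, hgi 0⟩
  have hempty : ⋂ m : ℕ, {p : E × ℝ | p.2 ∈ Set.Ioc 0 (2 / (m + 1 : ℝ))} = ∅ := by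
    refine Set.eq_empty_of_forall_notMem fun p hp => ?_
    simp only [Set.mem_iInter, Set.mem_ofPred_eq] at hp
    obtain ⟨m, hm⟩ := exists_nat_one_div_lt (half_pos (hp 0).1)
    have := (hp m).2
    rw [show (2 / (m + 1 : ℝ)) = 2 * (1 / (m + 1 : ℝ)) by ring] at this
    linarith
  rw [hempty, setIntegral_empty] at hlim
  have := ENNReal.tendsto_ofReal hlim
  rw [ENNReal.ofReal_zero] at this
  refine this.congr fun m => ofReal_integral_eq_lintegral_ofReal (hgi m) ?_
  filter_upwards [self_mem_ae_restrict (hAm m)] with p hp using hg0 p hp.1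

/-- Cutoff approximation: for `s ∈ (0,1)`, a smooth
`u ∈ H¹(ℝ^{n+1}_+, x_{n+1}^{1-2s})` with vanishing trace on `{x_{n+1} = 0}`, and a smooth
cutoff `ζ` with `ζ = 1` on `[0,1]`, `ζ = 0` on `[2,∞)`, `0 ≤ ζ ≤ 1`, the functions
`w_m(x) := u(x)(1 - ζ(m x_{n+1}))` satisfy `‖∇(w_m - u)‖_{L²(w)} → 0` and
`‖w_m - u‖_{L²(w)} → 0`; in particular functions vanishing near `{x_{n+1} = 0}` are dense
(in the weighted `H¹` norm) among such zero-trace functions. -/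
theorem cutoff_density (n : ℕ) (s : ℝ) (hs : s ∈ Set.Ioo (0 : ℝ) 1)
    (u : (Fin n → ℝ) × ℝ → ℂ) (hu : ContDiff ℝ 1 u)
    (hu0 : ∀ x' : Fin n → ℝ, u (x', 0) = 0)
    (huH : IntegrableOn (fun p => p.2 ^ (1 - 2 * s) * (‖u p‖ ^ 2 + ‖fderiv ℝ u p‖ ^ 2))
      {p : (Fin n → ℝ) × ℝ | 0 < p.2})
    (ζ : ℝ → ℝ) (hζ : ContDiff ℝ (⊤ : ℕ∞) ζ)
    (hζ1 : ∀ t ∈ Set.Icc (0 : ℝ) 1, ζ t = 1)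
    (hζ0 : ∀ t : ℝ, 2 ≤ t → ζ t = 0)
    (hζb : ∀ t : ℝ, ζ t ∈ Set.Icc (0 : ℝ) 1) :
    Tendsto (fun m : ℕ => ∫ p in {p : (Fin n → ℝ) × ℝ | 0 < p.2},
        p.2 ^ (1 - 2 * s) *
          ‖fderiv ℝ (fun q : (Fin n → ℝ) × ℝ =>
              u q * (1 - (ζ ((m : ℝ) * q.2) : ℂ))) p - fderiv ℝ u p‖ ^ 2)
      atTop (nhds 0) ∧
    Tendsto (fun m : ℕ => ∫ p in {p : (Fin n → ℝ) × ℝ | 0 < p.2},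
        p.2 ^ (1 - 2 * s) * ‖u p * (1 - (ζ ((m : ℝ) * p.2) : ℂ)) - u p‖ ^ 2)
      atTop (nhds 0) ∧
    ∀ ε : ℝ, 0 < ε →
      ∃ v : (Fin n → ℝ) × ℝ → ℂ, ContDiff ℝ 1 v ∧
        (∃ δ : ℝ, 0 < δ ∧ ∀ p : (Fin n → ℝ) × ℝ, p.2 < δ → v p = 0) ∧
        (∫ p in {p : (Fin n → ℝ) × ℝ | 0 < p.2},
          p.2 ^ (1 - 2 * s) * (‖v p - u p‖ ^ 2 +
            ‖fderiv ℝ (fun q : (Fin n → ℝ) × ℝ => v q - u q) p‖ ^ 2)) < ε := by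
  obtain ⟨M, hM⟩ := isCompact_Icc.exists_bound_of_continuousOn
    (f := deriv ζ) (s := Set.Icc (0 : ℝ) 2) (hζ.continuous_deriv (by simp)).continuousOn
  have hζd : Differentiable ℝ ζ := hζ.differentiable (by simp)
  have hud : Differentiable ℝ u := hu.differentiable one_ne_zero
  set S := {p : (Fin n → ℝ) × ℝ | 0 < p.2}
  have hSm : MeasurableSet S := measurable_snd measurableSet_Ioi
  have hSo : IsOpen S := isOpen_lt continuous_const continuous_snd
  let k : ℕ → (Fin n → ℝ) × ℝ → ℝ := fun m p => p.2 ^ (1 - 2 * s) *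
    (‖ζ ((m : ℝ) * p.2) • u p‖ ^ 2 +
      ‖fderiv ℝ (fun q : (Fin n → ℝ) × ℝ => ζ ((m : ℝ) * q.2) • u q) p‖ ^ 2)
  have hk : Tendsto (fun m : ℕ => ∫⁻ p in S, ENNReal.ofReal (k m p)) atTop (nhds 0) := by
    rw [← tendsto_add_atTop_iff_nat 1]
    have hlim := ENNReal.Tendsto.const_mul (a := ENNReal.ofReal (2 + 4 * M ^ 2 / s))
      (tendsto_lintegral_slab huH fun p hp => mul_nonneg (Real.rpow_nonneg hp.le _) (by positivity))
      (Or.inr ENNReal.ofReal_ne_top)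
    rw [mul_zero] at hlim
    refine tendsto_of_tendsto_of_tendsto_of_le_of_le tendsto_const_nhds hlim
      (fun _ => zero_le) fun m => ?_
    have hm : (0 : ℝ) < m + 1 := by positivity
    have h := lintegral_weighted_energy_smul_le hu hu0 (T := 2 / (m + 1 : ℝ))
      (L := (m + 1) * M) (η := fun t => ζ ((m + 1 : ℝ) * t)) hs.1 (by positivity)
      (hζd.comp (differentiable_id.const_mul _))
      (fun t => abs_le.2 ⟨by linarith [(hζb ((m + 1 : ℝ) * t)).1], (hζb _).2⟩)
      (fun t ht => hζ0 _ (by rwa [div_le_iff₀' hm] at ht))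
      (fun t ht => by
        rw [deriv_comp_mul_left, smul_eq_mul, abs_mul, abs_of_pos hm]
        gcongr
        exact hM _ ⟨mul_nonneg hm.le ht.1.le, by rw [← le_div_iff₀' hm]; exact ht.2⟩)
    have hc : ((m + 1 : ℝ) * M) ^ 2 * (2 / (m + 1 : ℝ)) ^ 2 / s = 4 * M ^ 2 / s := by
      field_simp
      norm_num
    rw [hc] at h
    simpa only [k, Nat.cast_add, Nat.cast_one] using h
  have hle (m : ℕ) (f : (Fin n → ℝ) × ℝ → ℝ) (hf : ∀ p ∈ S, 0 ≤ f p ∧ f p ≤ k m p) :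
      ‖∫ p in S, f p‖ₑ ≤ ∫⁻ p in S, ENNReal.ofReal (k m p) := by
    refine (enorm_integral_le_lintegral_enorm _).trans (setLIntegral_mono' hSm fun p hp => ?_)
    rw [Real.enorm_of_nonneg (hf p hp).1]
    exact ENNReal.ofReal_le_ofReal (hf p hp).2
  have hdiff (m : ℕ) (q : (Fin n → ℝ) × ℝ) :
      u q * (1 - (ζ ((m : ℝ) * q.2) : ℂ)) - u q = -(ζ ((m : ℝ) * q.2) • u q) := by
    rw [Complex.real_smul]
    ring
  have hρ (m : ℕ) : Differentiable ℝ fun q : (Fin n → ℝ) × ℝ => ζ ((m : ℝ) * q.2) :=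
    hζd.comp (differentiable_snd.const_mul _)
  have hfd (m : ℕ) (p : (Fin n → ℝ) × ℝ) :
      fderiv ℝ (fun q => u q * (1 - (ζ ((m : ℝ) * q.2) : ℂ)) - u q) p =
        -fderiv ℝ (fun q : (Fin n → ℝ) × ℝ => ζ ((m : ℝ) * q.2) • u q) p := by
    simp only [hdiff]
    exact fderiv_neg
  refine ⟨?_, ?_, fun ε hε => ?_⟩
  · refine tendsto_zero_iff_enorm_tendsto_zero.2
      (tendsto_of_tendsto_of_tendsto_of_le_of_le tendsto_const_nhds hk (fun _ => zero_le)
        fun m => hle m _ fun p hp => ?_)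
    have hw : 0 ≤ p.2 ^ (1 - 2 * s) := Real.rpow_nonneg (le_of_lt hp) _
    have hwd : DifferentiableAt ℝ (fun q : (Fin n → ℝ) × ℝ =>
        u q * (1 - (ζ ((m : ℝ) * q.2) : ℂ))) p :=
      (hud p).mul ((differentiableAt_const _).sub (Complex.ofRealCLM.differentiableAt.comp p (hρ m p)))
    refine ⟨by positivity, ?_⟩
    rw [← fderiv_fun_sub hwd (hud p), hfd, norm_neg]
    exact mul_le_mul_of_nonneg_left (le_add_of_nonneg_left (sq_nonneg _)) hw
  · refine tendsto_zero_iff_enorm_tendsto_zero.2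
      (tendsto_of_tendsto_of_tendsto_of_le_of_le tendsto_const_nhds hk (fun _ => zero_le)
        fun m => hle m _ fun p hp => ?_)
    have hw : 0 ≤ p.2 ^ (1 - 2 * s) := Real.rpow_nonneg (le_of_lt hp) _
    refine ⟨by positivity, ?_⟩
    rw [hdiff, norm_neg]
    exact mul_le_mul_of_nonneg_left (le_add_of_nonneg_right (sq_nonneg _)) hw
  · obtain ⟨m, hmε, hm0⟩ := ((hk.eventually_lt_const (ENNReal.ofReal_pos.2 hε)).and
      (eventually_gt_atTop 0)).exists
    have hm : (0 : ℝ) < m := Nat.cast_pos.2 hm0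
    let ρ : ℝ → ℝ := fun t => if t ≤ 0 then 0 else 1 - ζ (m * t)
    have hρ0 : ∀ t < 1 / (m : ℝ), ρ t = 0 := by
      intro t ht
      by_cases h : t ≤ 0
      · simp [ρ, h]
      · rw [lt_div_iff₀' hm] at ht
        simp [ρ, h, hζ1 (m * t) ⟨mul_nonneg hm.le (not_le.1 h).le, ht.le⟩]
    have hρ1 : ∀ t, 0 < t → ρ t = 1 - ζ (m * t) := fun t ht => by simp [ρ, not_le.2 ht]
    have hρc : ContDiff ℝ 1 ρ := by
      refine contDiff_iff_contDiffAt.2 fun t => ?_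
      rcases lt_or_ge t (1 / (m : ℝ)) with ht | ht
      · refine contDiffAt_const.congr_of_eventuallyEq (f := fun _ => (0 : ℝ)) ?_
        filter_upwards [gt_mem_nhds ht] with r hr using hρ0 r hr
      · have hζm : ContDiff ℝ 1 fun t : ℝ => 1 - ζ (m * t) :=
          contDiff_const.sub ((hζ.of_le (by simp)).comp (contDiff_const.mul contDiff_id))
        refine hζm.contDiffAt.congr_of_eventuallyEq ?_
        filter_upwards [lt_mem_nhds (lt_of_lt_of_le (by positivity) ht)] with r hr using hρ1 r hr
    have hv : ∀ q ∈ S, u q * (ρ q.2 : ℂ) = u q * (1 - (ζ ((m : ℝ) * q.2) : ℂ)) := fun q hq => by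
      rw [hρ1 _ hq]
      push_cast
      rfl
    refine ⟨fun q => u q * (ρ q.2 : ℂ),
      hu.mul (Complex.ofRealCLM.contDiff.comp (hρc.comp contDiff_snd)),
      ⟨1 / (m : ℝ), by positivity, fun p hp => by simp [hρ0 _ hp]⟩, ?_⟩
    have hint := (hle m (fun p => p.2 ^ (1 - 2 * s) * (‖u p * (ρ p.2 : ℂ) - u p‖ ^ 2 +
        ‖fderiv ℝ (fun q : (Fin n → ℝ) × ℝ => u q * (ρ q.2 : ℂ) - u q) p‖ ^ 2)) fun p hp => ?_)
    · have h := hint.trans_lt hmε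
      rw [← ofReal_norm, ENNReal.ofReal_lt_ofReal_iff hε] at h
      exact (le_abs_self _).trans_lt h
    · have hw : 0 ≤ p.2 ^ (1 - 2 * s) := Real.rpow_nonneg (le_of_lt hp) _
      have hev : (fun q : (Fin n → ℝ) × ℝ => u q * (ρ q.2 : ℂ) - u q) =ᶠ[nhds p]
          fun q => u q * (1 - (ζ ((m : ℝ) * q.2) : ℂ)) - u q := by
        filter_upwards [hSo.mem_nhds hp] with q hq
        rw [hv q hq]
      refine ⟨by positivity, ?_⟩
      rw [hev.fderiv_eq, hfd, norm_neg, hv p hp, hdiff, norm_neg]
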